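/- arXiv:math/0312132 — 2 statements merged into one kernel-verified Lean document; each statement's English description precedes it below -/
import Mathlib

section
/- Assume additionally S_α(0) = 1/2. Let j be an index with C_{jj} > 0, let ε ∈ {−1, 1}, and let q_{ε,j,t} ∈ ℝ^d be the vector obtained by applying Φ⁻¹∘S_α componentwise to ε·√(t/C_{jj})·e_j (so its j-th component is Φ⁻¹(S_α(ε√(t/C_{jj}))) and all other components are 0). With I(y) = |y|²/2 + (d/2)·log(2π), one has, as t → ∞: I(q_{ε,j,t}) = (α/2)·log t − (1/2)·log log √t − log(K·α^(α/2)·2√π) + (d/2)·log(2π) − (α/2)·log C_{jj} + o(1). -/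
open MeasureTheory Filter Set Asymptotics
open scoped Topology

noncomputable section

/-- The standard normal cumulative distribution function `Φ`. -/
def normCDF (y : ℝ) : ℝ := ∫ u in Iic y, Real.exp (-u ^ 2 / 2) / Real.sqrt (2 * Real.pi)

theorem integrable_normPDF :
    Integrable fun u : ℝ => Real.exp (-u ^ 2 / 2) / Real.sqrt (2 * Real.pi) := by
  have h := (integrable_exp_neg_mul_sq (b := 1 / 2) (by norm_num)).div_const
    (Real.sqrt (2 * Real.pi))
  refine h.congr (Eventually.of_forall fun u => ?_)
  ring_nf

theorem continuous_normPDF :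
    Continuous fun u : ℝ => Real.exp (-u ^ 2 / 2) / Real.sqrt (2 * Real.pi) := by
  fun_prop

theorem integral_normPDF :
    ∫ u : ℝ, Real.exp (-u ^ 2 / 2) / Real.sqrt (2 * Real.pi) = 1 := by
  have h := integral_gaussian (1 / 2)
  have hsq : Real.sqrt (Real.pi / (1 / 2)) = Real.sqrt (2 * Real.pi) := by
    congr 1
    ring
  rw [hsq] at h
  have hpos : 0 < Real.sqrt (2 * Real.pi) := by positivity
  rw [integral_div, div_eq_one_iff_eq hpos.ne', ← h]
  congr 1 with u
  ring_nf

theorem hasDerivAt_normCDF (y : ℝ) :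
    HasDerivAt normCDF (Real.exp (-y ^ 2 / 2) / Real.sqrt (2 * Real.pi)) y := by
  have h : normCDF = fun y => normCDF 0 +
      ∫ u in (0 : ℝ)..y, Real.exp (-u ^ 2 / 2) / Real.sqrt (2 * Real.pi) := by
    funext y
    rw [← intervalIntegral.integral_Iic_sub_Iic integrable_normPDF.integrableOn
      integrable_normPDF.integrableOn]
    simp only [normCDF]
    ring
  rw [h]
  exact (intervalIntegral.integral_hasDerivAt_right
    (continuous_normPDF.intervalIntegrable _ _)
    (continuous_normPDF.stronglyMeasurableAtFilter _ _)
    continuous_normPDF.continuousAt).const_add _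

theorem strictMono_normCDF : StrictMono normCDF :=
  strictMono_of_deriv_pos fun y => by
    rw [(hasDerivAt_normCDF y).deriv]
    positivity

theorem tendsto_normCDF_atTop : Tendsto normCDF atTop (𝓝 1) := by
  rw [← integral_normPDF]
  exact (aecover_Iic tendsto_id).integral_tendsto_of_countably_generated integrable_normPDF

theorem normCDF_lt_one (y : ℝ) : normCDF y < 1 :=
  (strictMono_normCDF (lt_add_one y)).trans_le
    (strictMono_normCDF.monotone.ge_of_tendsto tendsto_normCDF_atTop _)

theorem normCDF_neg (y : ℝ) : normCDF (-y) = 1 - normCDF y := by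
  have h := intervalIntegral.integral_Iic_add_Ioi (b := y)
    integrable_normPDF.integrableOn integrable_normPDF.integrableOn
  have hneg := integral_comp_neg_Iic (-y)
    fun u : ℝ => Real.exp (-u ^ 2 / 2) / Real.sqrt (2 * Real.pi)
  simp only [neg_neg, neg_sq] at hneg
  rw [integral_normPDF, ← hneg] at h
  simp only [normCDF]
  linarith

/-- Asymptotics of the Gaussian tail (Mills ratio). -/
theorem tendsto_one_sub_normCDF_div :
    Tendsto (fun y => (1 - normCDF y) /
      (Real.exp (-y ^ 2 / 2) / Real.sqrt (2 * Real.pi) * y⁻¹)) atTop (𝓝 1) := by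
  have hsqrt : 0 < Real.sqrt (2 * Real.pi) := by positivity
  have hpdf (y : ℝ) : HasDerivAt
      (fun u : ℝ => Real.exp (-u ^ 2 / 2) / Real.sqrt (2 * Real.pi))
      (Real.exp (-y ^ 2 / 2) * (-(2 * y) / 2) / Real.sqrt (2 * Real.pi)) y := by
    have h := ((((hasDerivAt_pow 2 y).neg).div_const 2).exp).div_const (Real.sqrt (2 * Real.pi))
    simpa using h
  refine HasDerivAt.lhopital_zero_atTop
    (f' := fun y => -(Real.exp (-y ^ 2 / 2) / Real.sqrt (2 * Real.pi)))
    (g' := fun y => -(Real.exp (-y ^ 2 / 2) / Real.sqrt (2 * Real.pi) * (1 + (y ^ 2)⁻¹)))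
    ?_ ?_ ?_ ?_ ?_ ?_
  · exact Eventually.of_forall fun y => (hasDerivAt_normCDF y).const_sub 1
  · filter_upwards [eventually_gt_atTop 0] with y hy
    refine ((hpdf y).mul (hasDerivAt_inv hy.ne')).congr_deriv ?_
    field_simp
    ring
  · filter_upwards [eventually_gt_atTop 0] with y hy
    exact (neg_neg_of_pos (by positivity)).ne
  · simpa using tendsto_normCDF_atTop.const_sub 1
  · refine squeeze_zero' (g := fun y => 1 / Real.sqrt (2 * Real.pi) * y⁻¹) ?_ ?_ ?_
    · filter_upwards [eventually_gt_atTop 0] with y hy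
      positivity
    · filter_upwards [eventually_gt_atTop 0] with y hy
      gcongr
      exact Real.exp_le_one_iff.2 (by nlinarith [sq_nonneg y])
    · simpa using tendsto_inv_atTop_zero.const_mul (1 / Real.sqrt (2 * Real.pi))
  · have h : Tendsto (fun y : ℝ => (1 + (y ^ 2)⁻¹)⁻¹) atTop (𝓝 1) := by
      have h2 : Tendsto (fun y : ℝ => (y ^ 2)⁻¹) atTop (𝓝 0) :=
        (tendsto_pow_atTop two_ne_zero).inv_tendsto_atTop
      simpa using (h2.const_add 1).inv₀ (by norm_num)
    refine h.congr' ?_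
    filter_upwards [eventually_gt_atTop 0] with y hy
    field_simp

theorem tendsto_log_one_sub_normCDF :
    Tendsto (fun y => Real.log (1 - normCDF y) + y ^ 2 / 2 + Real.log y +
      Real.log (Real.sqrt (2 * Real.pi))) atTop (𝓝 0) := by
  have h := tendsto_one_sub_normCDF_div.log one_ne_zero
  rw [Real.log_one] at h
  refine h.congr' ?_
  filter_upwards [eventually_gt_atTop 0] with y hy
  have hsqrt : 0 < Real.sqrt (2 * Real.pi) := by positivity
  have h1 : 0 < 1 - normCDF y := sub_pos.2 (normCDF_lt_one y)
  rw [Real.log_div h1.ne' (by positivity), Real.log_mul (by positivity) (by positivity),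
    Real.log_div (by positivity) hsqrt.ne', Real.log_exp, Real.log_inv]
  ring

/-- If `f / g → 1`, then `log f - log g → 0`. -/
theorem tendsto_log_sub_log_of_div {ι : Type*} {l : Filter ι} {f g : ι → ℝ}
    (h : Tendsto (fun t => f t / g t) l (𝓝 1)) :
    Tendsto (fun t => Real.log (f t) - Real.log (g t)) l (𝓝 0) := by
  have hlog := h.log one_ne_zero
  rw [Real.log_one] at hlog
  refine hlog.congr' ?_
  filter_upwards [h.eventually_ne one_ne_zero] with t ht
  exact Real.log_div (fun h0 => ht (by simp [h0])) (fun h0 => ht (by simp [h0]))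

/-- Asymptotic inversion of `L = z² / 2 + log z + o(1)`. -/
theorem tendsto_half_sq_sub_of_add_log {ι : Type*} {l : Filter ι} {z L : ι → ℝ}
    (hz : Tendsto z l atTop)
    (h : Tendsto (fun t => z t ^ 2 / 2 + Real.log (z t) - L t) l (𝓝 0)) :
    Tendsto (fun t => z t ^ 2 / 2 - (L t - Real.log (2 * L t) / 2)) l (𝓝 0) := by
  have hlog : Tendsto (fun t => Real.log (z t) / z t ^ 2) l (𝓝 0) := by
    have h0 := (Real.isLittleO_pow_log_id_atTop (n := 1)).tendsto_div_nhds_zero.comp hz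
    have h1 := h0.mul (tendsto_inv_atTop_zero.comp hz)
    rw [mul_zero] at h1
    refine h1.congr fun t => ?_
    simp only [Function.comp, pow_one, id]
    rw [sq, div_eq_mul_inv, div_eq_mul_inv, mul_inv, mul_assoc]
  have hrem := h.mul (((tendsto_pow_atTop two_ne_zero).comp hz).inv_tendsto_atTop)
  have hratio : Tendsto (fun t => 2 * L t / z t ^ 2) l (𝓝 1) := by
    have h1 := (hlog.sub hrem).const_mul 2 |>.const_add 1
    simp only [sub_zero, mul_zero, add_zero] at h1
    refine h1.congr' ?_
    filter_upwards [hz.eventually_gt_atTop 0] with t ht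
    simp only [Pi.inv_apply, Function.comp]
    field_simp
    ring
  have h2 := h.add ((tendsto_log_sub_log_of_div hratio).div_const 2)
  simp only [zero_div, add_zero] at h2
  refine h2.congr fun t => ?_
  rw [Real.log_pow]
  push_cast
  ring

/-- Squared Gaussian quantile at a level with regularly varying tail. -/
theorem tendsto_half_sq_of_normCDF_tail {α A c : ℝ} (hα : 0 < α) (hA : 0 < A) (hc : 0 < c)
    {z p : ℝ → ℝ} (hz : ∀ t, 1 - normCDF (z t) = p (Real.sqrt (t / c)))
    (hp : p ~[atTop] fun x => A / x ^ α) :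
    Tendsto (fun t => z t ^ 2 / 2 - (α / 2 * Real.log t - Real.log (α * Real.log t) / 2 +
      (-Real.log A - α / 2 * Real.log c - Real.log (Real.sqrt (2 * Real.pi))))) atTop (𝓝 0) := by
  have hx : Tendsto (fun t => Real.sqrt (t / c)) atTop atTop :=
    Real.tendsto_sqrt_atTop.comp (tendsto_id.atTop_div_const hc)
  have hp0 : Tendsto p atTop (𝓝 0) :=
    hp.symm.tendsto_nhds ((tendsto_rpow_atTop hα).const_div_atTop A)
  have hz_top : Tendsto z atTop atTop := by
    refine tendsto_atTop.2 fun M => ?_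
    filter_upwards [(hp0.comp hx).eventually_lt_const (sub_pos.2 (normCDF_lt_one M))] with t ht
    rw [Function.comp, ← hz t] at ht
    exact (strictMono_normCDF.lt_iff_lt.1 (by linarith)).le
  set b := Real.log (Real.sqrt (2 * Real.pi))
  set L : ℝ → ℝ := fun t => -Real.log (1 - normCDF (z t)) - b with hL
  have hinv := tendsto_half_sq_sub_of_add_log (L := L) hz_top
    ((tendsto_log_one_sub_normCDF.comp hz_top).congr fun t => by
      simp only [hL, Function.comp]; ring)
  have hLlim : Tendsto (fun t => L t - α / 2 * Real.log t) atTop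
      (𝓝 (-Real.log A - α / 2 * Real.log c - b)) := by
    have hdiv : Tendsto (fun x => p x / (A / x ^ α)) atTop (𝓝 1) := by
      refine (isEquivalent_iff_tendsto_one ?_).1 hp
      filter_upwards [eventually_gt_atTop 0] with x hx
      positivity
    have h1 := ((tendsto_log_sub_log_of_div hdiv).comp hx).const_sub
      (-Real.log A - α / 2 * Real.log c - b)
    rw [sub_zero] at h1
    refine h1.congr' ?_
    filter_upwards [eventually_gt_atTop 0] with t ht
    have hs : 0 < Real.sqrt (t / c) := by positivity
    simp only [hL, Function.comp, hz t]
    rw [Real.log_div hA.ne' (by positivity), Real.log_rpow hs, Real.log_sqrt (by positivity),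
      Real.log_div ht.ne' hc.ne']
    ring
  have hratio : Tendsto (fun t => 2 * L t / (α * Real.log t)) atTop (𝓝 1) := by
    have h1 := ((hLlim.mul Real.tendsto_log_atTop.inv_tendsto_atTop).const_mul
      (2 / α)).const_add 1
    simp only [mul_zero, add_zero] at h1
    refine h1.congr' ?_
    filter_upwards [Real.tendsto_log_atTop.eventually_gt_atTop 0] with t ht
    simp only [Pi.inv_apply]
    field_simp
    ring
  have h2 := (hinv.add (hLlim.sub_const (-Real.log A - α / 2 * Real.log c - b))).sub
    ((tendsto_log_sub_log_of_div hratio).div_const 2)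
  simp only [sub_self, zero_div, add_zero] at h2
  refine h2.congr fun t => ?_
  ring


/-- **Proposition 8.2.4 (value part).** With `I(y) = |y|²/2 + (d/2) log(2π)` and
`q_{ε,j,t}` the image of `ε √(t/C_{jj}) e_j` under the componentwise map `Φ⁻¹∘S_α`
(assuming `S_α(0) = 1/2`, its components off `j` vanish), one has, as `t → ∞`,
`I(q_{ε,j,t}) = (α/2) log t − (1/2) log log √t − log(K α^(α/2) 2√π)
  + (d/2) log(2π) − (α/2) log C_{jj} + o(1)`. -/
theorem I_of_q_asymptotic
    {d : ℕ}
    (α K : ℝ) (hα : 0 < α) (hK : 0 < K)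
    (sα Sα : ℝ → ℝ)
    (hs_cont : Continuous sα) (hs_pos : ∀ x, 0 < sα x)
    (hSα : ∀ x, Sα x = ∫ u in Iic x, sα u)
    (hrange : ∀ x, Sα x ∈ Ioo (0 : ℝ) 1)
    (hhalf : Sα 0 = 1 / 2)
    (htail_left : (fun x => Sα (-x)) ~[atTop] fun x => K * α ^ ((α - 1) / 2) / x ^ α)
    (htail_right : (fun x => 1 - Sα x) ~[atTop] fun x => K * α ^ ((α - 1) / 2) / x ^ α)
    (Φinv : ℝ → ℝ) (hΦinv : ∀ p ∈ Ioo (0 : ℝ) 1, normCDF (Φinv p) = p)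
    (C : Matrix (Fin d) (Fin d) ℝ) (j : Fin d) (hj : 0 < C j j)
    (ε : ℝ) (hε : ε = -1 ∨ ε = 1)
    (Ifun : (Fin d → ℝ) → ℝ)
    (hIfun : Ifun = fun y => (∑ i, y i ^ 2) / 2 + (d / 2 : ℝ) * Real.log (2 * Real.pi))
    (q : ℝ → Fin d → ℝ)
    (hq : q = fun t i => if i = j then Φinv (Sα (ε * Real.sqrt (t / C j j))) else 0) :
    Tendsto
      (fun t => Ifun (q t) -
        ((α / 2) * Real.log t - (1 / 2) * Real.log (Real.log (Real.sqrt t)) -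
          Real.log (K * α ^ (α / 2) * (2 * Real.sqrt Real.pi)) +
          (d / 2 : ℝ) * Real.log (2 * Real.pi) - (α / 2) * Real.log (C j j)))
      atTop (𝓝 0) := by
  have hA : 0 < K * α ^ ((α - 1) / 2) := by positivity
  have hquant : Tendsto (fun t => q t j ^ 2 / 2 -
      (α / 2 * Real.log t - Real.log (α * Real.log t) / 2 +
        (-Real.log (K * α ^ ((α - 1) / 2)) - α / 2 * Real.log (C j j) -
          Real.log (Real.sqrt (2 * Real.pi))))) atTop (𝓝 0) := by
    rcases hε with rfl | rfl
    · have h := tendsto_half_sq_of_normCDF_tail hα hA hj (z := fun t => -q t j)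
        (fun t => by simp [← normCDF_neg, hq, hΦinv _ (hrange _)]) htail_left
      simpa only [neg_sq] using h
    · exact tendsto_half_sq_of_normCDF_tail hα hA hj (z := fun t => q t j)
        (fun t => by simp [hq, hΦinv _ (hrange _)]) htail_right
  refine hquant.congr' ?_
  filter_upwards [eventually_gt_atTop 1] with t ht
  have hlog : 0 < Real.log t := Real.log_pos ht
  have hsum : ∑ i, q t i ^ 2 = q t j ^ 2 :=
    Finset.sum_eq_single j (fun i _ hi => by simp [hq, hi]) (by simp)
  rw [hIfun]
  simp only [hsum]
  have hpi := Real.pi_pos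
  have hconst : Real.log (K * α ^ (α / 2) * (2 * Real.sqrt Real.pi)) =
      Real.log K + α / 2 * Real.log α + (Real.log 2 + Real.log Real.pi / 2) := by
    rw [Real.log_mul (by positivity) (by positivity), Real.log_mul hK.ne' (by positivity),
      Real.log_rpow hα, Real.log_mul two_ne_zero (by positivity), Real.log_sqrt hpi.le]
  rw [hconst, Real.log_sqrt (by positivity), Real.log_sqrt (by positivity),
    Real.log_mul hK.ne' (by positivity), Real.log_rpow hα,
    Real.log_mul hα.ne' hlog.ne', Real.log_mul two_ne_zero hpi.ne',
    Real.log_div hlog.ne' two_ne_zero]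
  ring

end
end

section
/- Under the nondegeneracy assumption (8.2.8), there exists a constant K₀ > 0, depending only on the matrix C, such that for every I ∈ J(C), every m ∈ M_I, and every i ∈ I: |m|/K₀ ≤ |m_i| ≤ K₀·|m|, where m_i = ⟨m,e_i⟩ and |m| is the Euclidean norm. -/
open MeasureTheory Filter Set Asymptotics
open scoped Topology Classical

noncomputable section

/-- The quadratic form `⟨Cx, x⟩`. -/
def quadForm {d : ℕ} (C : Matrix (Fin d) (Fin d) ℝ) (x : Fin d → ℝ) : ℝ :=
  ∑ i, (∑ j, C i j * x j) * x i

/-- `x` lies in `V_I = span{e_i : i ∈ I}`. -/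
def suppIn {d : ℕ} (I : Finset (Fin d)) (x : Fin d → ℝ) : Prop :=
  ∀ i ∉ I, x i = 0

/-- `N(C)`, the minimal cardinality of a set `I` such that `⟨Cu,u⟩ > 0` for some `u ∈ V_I`. -/
def Ncal {d : ℕ} (C : Matrix (Fin d) (Fin d) ℝ) : ℕ :=
  sInf {n | ∃ I : Finset (Fin d), I.card = n ∧ ∃ u : Fin d → ℝ, suppIn I u ∧ 0 < quadForm C u}

/-- `J(C)`, the sets `I` of minimal cardinality `N(C)` carrying a vector with `⟨Cu,u⟩ > 0`. -/
def Jcal {d : ℕ} (C : Matrix (Fin d) (Fin d) ℝ) : Set (Finset (Fin d)) :=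
  {I | I.card = Ncal C ∧ ∃ u : Fin d → ℝ, suppIn I u ∧ 0 < quadForm C u}

/-- `M_I = {m ∈ V_I : ⟨Cm,m⟩ = 1}`. -/
def Mman {d : ℕ} (C : Matrix (Fin d) (Fin d) ℝ) (I : Finset (Fin d)) : Set (Fin d → ℝ) :=
  {m | suppIn I m ∧ quadForm C m = 1}

/-- The nondegeneracy assumption (8.2.8). -/
def Nondeg {d : ℕ} (C : Matrix (Fin d) (Fin d) ℝ) : Prop :=
  ∀ I : Finset (Fin d), I.card < Ncal C →
    ∀ u : Fin d → ℝ, suppIn I u → u ≠ 0 → quadForm C u < 0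

lemma continuous_quadForm {d : ℕ} (C : Matrix (Fin d) (Fin d) ℝ) : Continuous (quadForm C) := by
  unfold quadForm
  fun_prop

lemma quadForm_smul {d : ℕ} (C : Matrix (Fin d) (Fin d) ℝ) (a : ℝ) (x : Fin d → ℝ) :
    quadForm C (a • x) = a ^ 2 * quadForm C x := by
  simp only [quadForm, Pi.smul_apply, smul_eq_mul, Finset.mul_sum, Finset.sum_mul]
  exact Finset.sum_congr rfl fun i _ => Finset.sum_congr rfl fun j _ => by ring

lemma isClosed_setOf_suppIn {d : ℕ} (I : Finset (Fin d)) :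
    IsClosed {x : Fin d → ℝ | suppIn I x} := by
  simp only [suppIn, ofPred_forall]
  exact isClosed_iInter fun i => isClosed_iInter fun _ =>
    isClosed_eq (continuous_apply i) continuous_const

lemma abs_apply_le_sqrt_sum_sq {d : ℕ} (x : Fin d → ℝ) (i : Fin d) :
    |x i| ≤ Real.sqrt (∑ k, x k ^ 2) :=
  Real.abs_le_sqrt
    (Finset.single_le_sum (f := fun k => x k ^ 2) (fun k _ => sq_nonneg (x k)) (Finset.mem_univ i))

lemma isCompact_setOf_sum_sq_eq_one (d : ℕ) :
    IsCompact {x : Fin d → ℝ | ∑ k, x k ^ 2 = 1} := by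
  refine Metric.isCompact_of_isClosed_isBounded
    (isClosed_eq (by fun_prop) continuous_const) ?_
  refine (Metric.isBounded_closedBall (x := (0 : Fin d → ℝ)) (r := 1)).subset fun x hx => ?_
  rw [mem_closedBall_zero_iff, pi_norm_le_iff_of_nonneg zero_le_one]
  intro i
  simpa [show ∑ k, x k ^ 2 = 1 from hx] using abs_apply_le_sqrt_sum_sq x i

/-- Under nondegeneracy, no coordinate in `I` of a nonzero vector of `V_I` with `⟨Cx,x⟩ ≥ 0`
vanishes when `I` has the minimal cardinality. -/
lemma Nondeg.apply_ne_zero {d : ℕ} {C : Matrix (Fin d) (Fin d) ℝ} (hC : Nondeg C)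
    {I : Finset (Fin d)} (hI : I.card = Ncal C) {i : Fin d} (hi : i ∈ I) {x : Fin d → ℝ}
    (hx : suppIn I x) (hx0 : x ≠ 0) (hQ : 0 ≤ quadForm C x) : x i ≠ 0 := by
  intro hxi
  refine (hC (I.erase i) (hI ▸ Finset.card_erase_lt_of_mem hi) x (fun j hj => ?_) hx0).not_ge hQ
  by_cases hji : j = i
  · exact hji ▸ hxi
  · exact hx j fun hjI => hj (Finset.mem_erase.2 ⟨hji, hjI⟩)

lemma Nondeg.exists_mul_sqrt_le_abs {d : ℕ} {C : Matrix (Fin d) (Fin d) ℝ} (hC : Nondeg C)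
    {I : Finset (Fin d)} (hI : I.card = Ncal C) {i : Fin d} (hi : i ∈ I) :
    ∃ c : ℝ, 0 < c ∧ ∀ x : Fin d → ℝ, suppIn I x → 0 ≤ quadForm C x →
      c * Real.sqrt (∑ k, x k ^ 2) ≤ |x i| := by
  have hcpt : IsCompact ({x : Fin d → ℝ | ∑ k, x k ^ 2 = 1} ∩
      ({x | suppIn I x} ∩ {x | 0 ≤ quadForm C x})) :=
    (isCompact_setOf_sum_sq_eq_one d).inter_right
      ((isClosed_setOf_suppIn I).inter (isClosed_le continuous_const (continuous_quadForm C)))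
  obtain ⟨c, hc, hle⟩ := hcpt.exists_forall_le' (f := fun x => |x i|) (a := 0)
    (by fun_prop) fun x ⟨hx1, hx, hQ⟩ => abs_pos.2 <| hC.apply_ne_zero hI hi hx
      (by rintro rfl; simp at hx1) hQ
  refine ⟨c, hc, fun x hx hQ => ?_⟩
  set r := Real.sqrt (∑ k, x k ^ 2)
  have hr2 : r ^ 2 = ∑ k, x k ^ 2 := Real.sq_sqrt (Finset.sum_nonneg fun k _ => sq_nonneg _)
  have hr0 : 0 ≤ r := Real.sqrt_nonneg _
  rcases hr0.eq_or_lt with h0 | hpos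
  · simp [← h0]
  · have h := hle (r⁻¹ • x) ⟨?_, fun j hj => by simp [hx j hj], ?_⟩
    · rw [Pi.smul_apply, smul_eq_mul, abs_mul, abs_of_pos (inv_pos.2 hpos), inv_mul_eq_div,
        le_div_iff₀ hpos] at h
      exact h
    · simp only [mem_ofPred_eq, Pi.smul_apply, smul_eq_mul, mul_pow, ← Finset.mul_sum, ← hr2]
      field_simp
    · rw [mem_ofPred_eq, quadForm_smul]
      positivity

/-- **Lemma 8.2.16.** Under the nondegeneracy assumption (8.2.8), there exists a constant
`K₀ > 0`, depending only on `C`, such that for every `I ∈ J(C)`, every `m ∈ M_I` and every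
`i ∈ I`, one has `|m|/K₀ ≤ |m_i| ≤ K₀·|m|` (with `|m|` the Euclidean norm). -/
theorem Mman_coords_comparable_norm
    {d : ℕ} (C : Matrix (Fin d) (Fin d) ℝ)
    (hpos : ∃ u : Fin d → ℝ, 0 < quadForm C u)
    (hnondeg : Nondeg C) :
    ∃ K₀ : ℝ, 0 < K₀ ∧ ∀ I ∈ Jcal C, ∀ m ∈ Mman C I, ∀ i ∈ I,
      Real.sqrt (∑ k, m k ^ 2) / K₀ ≤ |m i| ∧ |m i| ≤ K₀ * Real.sqrt (∑ k, m k ^ 2) := by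
  have hev : ∀ I : Finset (Fin d), ∀ i : Fin d, ∀ᶠ K : ℝ in atTop, I ∈ Jcal C → i ∈ I →
      ∀ m ∈ Mman C I, Real.sqrt (∑ k, m k ^ 2) / K ≤ |m i| := by
    intro I i
    by_cases h : I ∈ Jcal C ∧ i ∈ I
    · obtain ⟨c, hc, hle⟩ := hnondeg.exists_mul_sqrt_le_abs h.1.1 h.2
      filter_upwards [eventually_ge_atTop c⁻¹] with K hK _ _ m hm
      refine le_trans ?_ (hle m hm.1 (hm.2 ▸ zero_le_one))
      rw [div_eq_inv_mul]
      exact mul_le_mul_of_nonneg_right (inv_le_of_inv_le₀ hc hK) (Real.sqrt_nonneg _)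
    · exact Eventually.of_forall fun K hI hi => absurd ⟨hI, hi⟩ h
  obtain ⟨K, hK, hK1⟩ := ((eventually_all.2 fun I => eventually_all.2 (hev I)).and
    (eventually_ge_atTop 1)).exists
  exact ⟨K, zero_lt_one.trans_le hK1, fun I hI m hm i hi => ⟨hK I i hI hi m hm,
    (abs_apply_le_sqrt_sum_sq m i).trans (le_mul_of_one_le_left (Real.sqrt_nonneg _) hK1)⟩⟩

end
end
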